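/- arXiv:2202.04167 — 5 statements merged into one kernel-verified Lean document; each statement's English description precedes it below -/
import Mathlib

section
/- For every z in S, E[D_F(X, z)] = E[D_F(X, E[X])] + D_F(E[X], z). Consequently, the expectation E[X] is the unique minimizer over S of the map z ↦ E[D_F(X, z)]. -/
open MeasureTheory
open scoped RealInnerProductSpace

/-- The Bregman divergence `D_F(y, x) = F y - F x - ⟪∇F x, y - x⟫`. -/
noncomputable def bregmanDiv {E : Type*} [NormedAddCommGroup E] [InnerProductSpace ℝ E]
    (F : E → ℝ) (f' : E → E) (y x : E) : ℝ :=
  F y - F x - ⟪f' x, y - x⟫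

/-- Strict convexity is preserved by precomposition with an injective affine map. -/
theorem StrictConvexOn.comp_affineMap_of_injective {E G : Type*} [AddCommGroup E] [Module ℝ E]
    [AddCommGroup G] [Module ℝ G] {S : Set E} {F : E → ℝ} (hF : StrictConvexOn ℝ S F)
    (g : G →ᵃ[ℝ] E) (hg : Function.Injective g) : StrictConvexOn ℝ (g ⁻¹' S) (F ∘ g) := by
  refine ⟨hF.1.affine_preimage g, fun x hx y hy hxy a b ha hb hab => ?_⟩
  rw [Function.comp_apply, Convex.combo_affine_apply hab]
  exact hF.2 hx hy (hg.ne hxy) ha hb hab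

theorem bregmanDiv_pos {E : Type*} [NormedAddCommGroup E] [InnerProductSpace ℝ E]
    [CompleteSpace E] {S : Set E} {F : E → ℝ} {f' : E → E} (hF : StrictConvexOn ℝ S F)
    {x y : E} (hx : x ∈ S) (hy : y ∈ S) (hxy : x ≠ y) (hd : HasGradientAt F (f' x) x) :
    0 < bregmanDiv F f' y x := by
  have hconv := hF.comp_affineMap_of_injective (AffineMap.lineMap x y)
    (AffineMap.lineMap_injective ℝ hxy)
  have hderiv : HasDerivAt (F ∘ AffineMap.lineMap x y) ⟪f' x, y - x⟫ (0 : ℝ) := by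
    have hd' : HasFDerivAt F (InnerProductSpace.toDual ℝ E (f' x))
        (AffineMap.lineMap x y (0 : ℝ)) := by
      rw [AffineMap.lineMap_apply_zero]
      exact hd.hasFDerivAt
    simpa using hd'.comp_hasDerivAt (0 : ℝ) AffineMap.hasDerivAt_lineMap
  have hslope := hconv.lt_slope_of_hasDerivAt (x := 0) (y := 1) (by simpa using hx)
    (by simpa using hy) one_pos hderiv
  simp only [slope_def_field, Function.comp_apply, AffineMap.lineMap_apply_zero,
    AffineMap.lineMap_apply_one, sub_zero, div_one] at hslope
  rw [bregmanDiv]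
  linarith

theorem integral_bregmanDiv {E : Type*} [NormedAddCommGroup E] [InnerProductSpace ℝ E]
    [CompleteSpace E] {Ω : Type*} [MeasurableSpace Ω] {μ : Measure Ω} [IsProbabilityMeasure μ]
    {F : E → ℝ} (f' : E → E) {X : Ω → E} (hX : Integrable X μ)
    (hFX : Integrable (fun ω => F (X ω)) μ) (z : E) :
    ∫ ω, bregmanDiv F f' (X ω) z ∂μ
      = (∫ ω, F (X ω) ∂μ) - F z - ⟪f' z, (∫ ω, X ω ∂μ) - z⟫ := by
  have hXz : Integrable (fun ω => X ω - z) μ := hX.sub (integrable_const z)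
  have hFz : Integrable (fun ω => F (X ω) - F z) μ := hFX.sub (integrable_const _)
  simp only [bregmanDiv]
  rw [integral_sub hFz (hXz.const_inner _),
    integral_sub hFX (integrable_const _), integral_inner hXz,
    integral_sub hX (integrable_const _)]
  simp

/-- for every `z ∈ S`,
`E[D_F(X, z)] = E[D_F(X, E[X])] + D_F(E[X], z)`; consequently `E[X]` is the unique
minimizer over `S` of `z ↦ E[D_F(X, z)]`. -/
theorem mean_minimizes_expected_divergence_from
    {E : Type*} [NormedAddCommGroup E] [InnerProductSpace ℝ E] [CompleteSpace E]
    {Ω : Type*} [MeasurableSpace Ω] (μ : Measure Ω) [IsProbabilityMeasure μ]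
    (S : Set E) (hS : Convex ℝ S) (F : E → ℝ) (f' : E → E)
    (hF : StrictConvexOn ℝ S F) (hdiff : ∀ x ∈ S, HasGradientAt F (f' x) x)
    (X : Ω → E) (hXS : ∀ ω, X ω ∈ S)
    (hXint : Integrable X μ)
    (hFX : Integrable (fun ω => F (X ω)) μ)
    (hf'X : Integrable (fun ω => f' (X ω)) μ)
    (hEX : (∫ ω, X ω ∂μ) ∈ S) :
    (∀ z ∈ S,
      ∫ ω, bregmanDiv F f' (X ω) z ∂μ
        = (∫ ω, bregmanDiv F f' (X ω) (∫ ω', X ω' ∂μ) ∂μ)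
          + bregmanDiv F f' (∫ ω', X ω' ∂μ) z) ∧
    (∀ z ∈ S, z ≠ ∫ ω', X ω' ∂μ →
      (∫ ω, bregmanDiv F f' (X ω) (∫ ω', X ω' ∂μ) ∂μ)
        < ∫ ω, bregmanDiv F f' (X ω) z ∂μ) := by
  have hpyth : ∀ z, ∫ ω, bregmanDiv F f' (X ω) z ∂μ
      = (∫ ω, bregmanDiv F f' (X ω) (∫ ω', X ω' ∂μ) ∂μ)
        + bregmanDiv F f' (∫ ω', X ω' ∂μ) z := fun z => by
    rw [integral_bregmanDiv f' hXint hFX, integral_bregmanDiv f' hXint hFX, bregmanDiv,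
      sub_self, inner_zero_right]
    ring
  refine ⟨fun z _ => hpyth z, fun z hz hne => ?_⟩
  rw [hpyth z]
  exact lt_add_of_pos_right _ (bregmanDiv_pos hF hz hEX hne (hdiff z hz))
end

section
/- Suppose z₀ ∈ S satisfies ∇F(z₀) = E[∇F(X)]. If the dual variance vanishes, i.e. E[D_F(z₀, X)] = 0, then X = z₀ almost surely. -/
open MeasureTheory
open scoped RealInnerProductSpace

/-- The first-order condition for convexity: a convex function lies above its tangent planes. -/
theorem ConvexOn.add_inner_gradient_le
    {E : Type*} [NormedAddCommGroup E] [InnerProductSpace ℝ E] [CompleteSpace E]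
    {S : Set E} {F : E → ℝ} (hF : ConvexOn ℝ S F) {x y g : E} (hx : x ∈ S) (hy : y ∈ S)
    (hg : HasGradientAt F g x) : F x + ⟪g, y - x⟫ ≤ F y := by
  have hline := hF.comp_affineMap (AffineMap.lineMap x y : ℝ →ᵃ[ℝ] E)
  have hderiv : HasDerivAt (F ∘ (AffineMap.lineMap x y : ℝ →ᵃ[ℝ] E)) ⟪g, y - x⟫ 0 := by
    have hg' : HasFDerivAt F (InnerProductSpace.toDual ℝ E g)
        ((AffineMap.lineMap x y : ℝ →ᵃ[ℝ] E) 0) := by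
      simpa using hg.hasFDerivAt
    simpa using hg'.comp_hasDerivAt (0 : ℝ) AffineMap.hasDerivAt_lineMap
  have hslope := hline.le_slope_of_hasDerivAt (x := 0) (y := 1) (by simpa using hx)
    (by simpa using hy) one_pos hderiv
  simp [slope_def_field] at hslope
  linarith

/-- The strict first-order condition for strict convexity. -/
theorem StrictConvexOn.add_inner_gradient_lt
    {E : Type*} [NormedAddCommGroup E] [InnerProductSpace ℝ E] [CompleteSpace E]
    {S : Set E} {F : E → ℝ} (hF : StrictConvexOn ℝ S F) {x y g : E} (hx : x ∈ S) (hy : y ∈ S)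
    (hxy : x ≠ y) (hg : HasGradientAt F g x) : F x + ⟪g, y - x⟫ < F y := by
  have hhalf : (0 : ℝ) < 1 / 2 := by norm_num
  have hmid := hF.2 hx hy hxy hhalf hhalf (by norm_num)
  have hle := hF.convexOn.add_inner_gradient_le hx
    (hF.1 hx hy hhalf.le hhalf.le (by norm_num)) hg
  have hsub : (1 / 2 : ℝ) • x + (1 / 2 : ℝ) • y - x = (1 / 2 : ℝ) • (y - x) := by module
  rw [hsub, inner_smul_right] at hle
  simp only [smul_eq_mul] at hmid
  linarith

/-- suppose `z₀ ∈ S` satisfies `∇F(z₀) = E[∇F(X)]`. If the dual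
variance vanishes, `E[D_F(z₀, X)] = 0`, then `X = z₀` almost surely. -/
theorem dual_variance_eq_zero
    {E : Type*} [NormedAddCommGroup E] [InnerProductSpace ℝ E] [CompleteSpace E]
    {Ω : Type*} [MeasurableSpace Ω] (μ : Measure Ω) [IsProbabilityMeasure μ]
    (S : Set E) (hS : Convex ℝ S) (F : E → ℝ) (f' : E → E)
    (hF : StrictConvexOn ℝ S F) (hdiff : ∀ x ∈ S, HasGradientAt F (f' x) x)
    (X : Ω → E) (hXS : ∀ ω, X ω ∈ S)
    (hXint : Integrable X μ)
    (hFX : Integrable (fun ω => F (X ω)) μ)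
    (hf'X : Integrable (fun ω => f' (X ω)) μ)
    (hinner : Integrable (fun ω => ⟪f' (X ω), X ω⟫) μ)
    (z₀ : E) (hz₀S : z₀ ∈ S) (hz₀ : f' z₀ = ∫ ω, f' (X ω) ∂μ)
    (hvar : ∫ ω, bregmanDiv F f' z₀ (X ω) ∂μ = 0) :
    ∀ᵐ ω ∂μ, X ω = z₀ := by
  have hnonneg : ∀ ω, 0 ≤ bregmanDiv F f' z₀ (X ω) := fun ω => by
    have h := hF.convexOn.add_inner_gradient_le (hXS ω) hz₀S (hdiff _ (hXS ω))
    unfold bregmanDiv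
    linarith
  have hint : Integrable (fun ω => bregmanDiv F f' z₀ (X ω)) μ := by
    simp only [bregmanDiv, inner_sub_right]
    exact ((integrable_const _).sub hFX).sub ((hf'X.inner_const z₀).sub hinner)
  filter_upwards [(integral_eq_zero_iff_of_nonneg hnonneg hint).1 hvar] with ω hω
  by_contra hne
  have h := hF.add_inner_gradient_lt (hXS ω) hz₀S hne (hdiff _ (hXS ω))
  simp only [bregmanDiv, Pi.zero_apply] at hω
  linarith
end

section
/- Primal averaging in label space leaves the bias unchanged and does not increase the primal variance: if Y₁, …, Yₙ are S-valued random variables each identically distributed as Y, and Ŷ := (1/n)·∑ᵢ Yᵢ, then E[Ŷ] = E[Y] (hence D_F(E[Ŷ], x) = D_F(E[Y], x) for any x ∈ S), and E[D_F(Ŷ, E[Y])] ≤ E[D_F(Y, E[Y])]. -/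
open MeasureTheory ProbabilityTheory
open scoped RealInnerProductSpace

/-- The expectation of a Bregman divergence in its first argument. -/
theorem integral_bregmanDiv_left {E : Type*} [NormedAddCommGroup E] [InnerProductSpace ℝ E]
    [CompleteSpace E] {Ω : Type*} [MeasurableSpace Ω] {μ : Measure Ω} [IsProbabilityMeasure μ]
    {F : E → ℝ} (f' : E → E) {Z : Ω → E} (hZ : Integrable Z μ)
    (hFZ : Integrable (fun ω => F (Z ω)) μ) (x : E) :
    ∫ ω, bregmanDiv F f' (Z ω) x ∂μ =
      (∫ ω, F (Z ω) ∂μ) - F x - ⟪f' x, (∫ ω, Z ω ∂μ) - x⟫ := by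
  have hsub : Integrable (fun ω => Z ω - x) μ := hZ.sub (integrable_const x)
  have hFsub : Integrable (fun ω => F (Z ω) - F x) μ := hFZ.sub (integrable_const _)
  simp only [bregmanDiv]
  rw [integral_sub hFsub (hsub.const_inner (f' x)), integral_sub hFZ (integrable_const _),
    integral_inner hsub, integral_sub hZ (integrable_const x)]
  simp

/-- Jensen's inequality for the uniform average of finitely many points. -/
theorem ConvexOn.map_uniform_average_le {E : Type*} [AddCommGroup E] [Module ℝ E]
    {S : Set E} {F : E → ℝ} (hF : ConvexOn ℝ S F) {n : ℕ} (hn : n ≠ 0)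
    {y : Fin n → E} (hy : ∀ i, y i ∈ S) :
    F ((n : ℝ)⁻¹ • ∑ i, y i) ≤ (n : ℝ)⁻¹ * ∑ i, F (y i) := by
  have h := hF.map_sum_le (t := Finset.univ) (w := fun _ => (n : ℝ)⁻¹) (p := y)
    (fun _ _ => by positivity) (by simp [hn]) (fun i _ => hy i)
  simpa only [← Finset.smul_sum, smul_eq_mul, ← Finset.mul_sum] using h

/-- The mean of a uniform average of random variables with a common law. -/
theorem integral_average_of_identDistrib {G : Type*} [NormedAddCommGroup G] [NormedSpace ℝ G]
    [MeasurableSpace G] [BorelSpace G] {Ω : Type*} [MeasurableSpace Ω]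
    {μ : Measure Ω} {n : ℕ} (hn : n ≠ 0) {Z : Ω → G} {Zs : Fin n → Ω → G}
    (hid : ∀ i, IdentDistrib (Zs i) Z μ μ) (hZ : Integrable Z μ) :
    ∫ ω, (n : ℝ)⁻¹ • ∑ i, Zs i ω ∂μ = ∫ ω, Z ω ∂μ := by
  have hn' : (n : ℝ) ≠ 0 := Nat.cast_ne_zero.mpr hn
  rw [integral_smul, integral_finsetSum _ fun i _ => (hid i).integrable_iff.mpr hZ,
    Finset.sum_congr rfl fun i _ => (hid i).integral_eq, Finset.sum_const, Finset.card_univ,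
    Fintype.card_fin, ← Nat.cast_smul_eq_nsmul ℝ, inv_smul_smul₀ hn']

/-- primal averaging in label space leaves the bias unchanged and
does not increase the primal variance: if `Y₁, …, Yₙ` are each identically
distributed as `Y` and `Ŷ := (1/n) ∑ᵢ Yᵢ`, then `E[Ŷ] = E[Y]` (hence
`D_F(E[Ŷ], x) = D_F(E[Y], x)` for any `x ∈ S`), and
`E[D_F(Ŷ, E[Y])] ≤ E[D_F(Y, E[Y])]`. -/
theorem primal_averaging_label_space
    {E : Type*} [NormedAddCommGroup E] [InnerProductSpace ℝ E] [CompleteSpace E]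
    [MeasurableSpace E] [BorelSpace E]
    {Ω : Type*} [MeasurableSpace Ω] (μ : Measure Ω) [IsProbabilityMeasure μ]
    (S : Set E) (hS : Convex ℝ S) (F : E → ℝ) (f' : E → E)
    (hF : StrictConvexOn ℝ S F) (hdiff : ∀ x ∈ S, HasGradientAt F (f' x) x)
    (hFmeas : Measurable F)
    (n : ℕ) (hn : 1 ≤ n)
    (Y : Ω → E) (Ys : Fin n → Ω → E)
    (hYm : Measurable Y) (hYsm : ∀ i, Measurable (Ys i))
    (hYS : ∀ ω, Y ω ∈ S) (hYsS : ∀ i ω, Ys i ω ∈ S)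
    (hid : ∀ i, IdentDistrib (Ys i) Y μ μ)
    (Yhat : Ω → E) (hYhat : ∀ ω, Yhat ω = (n : ℝ)⁻¹ • ∑ i, Ys i ω)
    (hYint : Integrable Y μ)
    (hFY : Integrable (fun ω => F (Y ω)) μ)
    (hFYhat : Integrable (fun ω => F (Yhat ω)) μ)
    (hEY : (∫ ω, Y ω ∂μ) ∈ S) :
    (∫ ω, Yhat ω ∂μ) = (∫ ω, Y ω ∂μ) ∧
    (∀ x ∈ S,
      bregmanDiv F f' (∫ ω, Yhat ω ∂μ) x = bregmanDiv F f' (∫ ω, Y ω ∂μ) x) ∧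
    (∫ ω, bregmanDiv F f' (Yhat ω) (∫ ω', Y ω' ∂μ) ∂μ)
      ≤ ∫ ω, bregmanDiv F f' (Y ω) (∫ ω', Y ω' ∂μ) ∂μ := by
  have hn0 : n ≠ 0 := Nat.one_le_iff_ne_zero.mp hn
  obtain rfl : Yhat = fun ω => (n : ℝ)⁻¹ • ∑ i, Ys i ω := funext hYhat
  have hmean := integral_average_of_identDistrib hn0 hid hYint
  have hidF : ∀ i, IdentDistrib (fun ω => F (Ys i ω)) (fun ω => F (Y ω)) μ μ :=
    fun i => (hid i).comp hFmeas
  have hhat : Integrable (fun ω => (n : ℝ)⁻¹ • ∑ i, Ys i ω) μ :=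
    (integrable_finsetSum _ fun i _ => (hid i).integrable_iff.mpr hYint).smul _
  refine ⟨hmean, fun x _ => by rw [hmean], ?_⟩
  rw [integral_bregmanDiv_left f' hhat hFYhat, integral_bregmanDiv_left f' hYint hFY, hmean]
  refine sub_le_sub_right (sub_le_sub_right ?_ _) _
  calc ∫ ω, F ((n : ℝ)⁻¹ • ∑ i, Ys i ω) ∂μ
      ≤ ∫ ω, (n : ℝ)⁻¹ • ∑ i, F (Ys i ω) ∂μ :=
        integral_mono hFYhat
          ((integrable_finsetSum _ fun i _ => (hidF i).integrable_iff.mpr hFY).smul (n : ℝ)⁻¹)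
          fun ω => hF.convexOn.map_uniform_average_le hn0 fun i => hYsS i ω
    _ = ∫ ω, F (Y ω) ∂μ := integral_average_of_identDistrib hn0 hidF hFY
end

section
/- If the Bregman divergence D_F is jointly convex on S × S, then primal averaging does not increase the dual variance: if X₁, …, Xₙ are S-valued random variables each identically distributed as X, X̂ := (1/n)·∑ᵢ Xᵢ, z₀ ∈ S satisfies ∇F(z₀) = E[∇F(X)], and ẑ ∈ S satisfies ∇F(ẑ) = E[∇F(X̂)], then E[D_F(ẑ, X̂)] ≤ E[D_F(z₀, X)]. -/
open MeasureTheory ProbabilityTheory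
open scoped RealInnerProductSpace

/-- A measurable function whose composition with `X` is a.e. strongly measurable is a.e. strongly
measurable for the law of `X`; the codomain need not be second countable. -/
theorem aestronglyMeasurable_map_of_comp {Ω E G : Type*} [MeasurableSpace Ω] [MeasurableSpace E]
    [TopologicalSpace G] [TopologicalSpace.PseudoMetrizableSpace G] [MeasurableSpace G]
    [BorelSpace G] {μ : Measure Ω} {X : Ω → E} {g : E → G} (hX : Measurable X)
    (hg : Measurable g) (h : AEStronglyMeasurable (fun ω => g (X ω)) μ) :
    AEStronglyMeasurable g (μ.map X) := by
  obtain ⟨-, t, ht, hgt⟩ := aestronglyMeasurable_iff_aemeasurable_separable.1 h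
  refine aestronglyMeasurable_iff_aemeasurable_separable.2
    ⟨hg.aemeasurable, closure t, ht.closure, ?_⟩
  rw [ae_map_iff hX.aemeasurable (hg isClosed_closure.measurableSet)]
  filter_upwards [hgt] with ω hω using subset_closure hω

section Bregman

variable {E : Type*} [NormedAddCommGroup E] [InnerProductSpace ℝ E]

/-- The three-point identity for the Bregman divergence. -/
theorem bregmanDiv_three_point (F : E → ℝ) (f' : E → E) (y z x : E) :
    bregmanDiv F f' y x =
      bregmanDiv F f' z x + bregmanDiv F f' y z + ⟪f' z - f' x, y - z⟫ := by
  simp only [bregmanDiv, inner_sub_left, inner_sub_right]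
  ring

/-- The Bregman divergence of a convex function is nonnegative. -/
theorem bregmanDiv_nonneg [CompleteSpace E] {S : Set E} {F : E → ℝ} {f' : E → E} {x y : E}
    (hF : ConvexOn ℝ S F) (hx : x ∈ S) (hy : y ∈ S) (hd : HasGradientAt F (f' x) x) :
    0 ≤ bregmanDiv F f' y x := by
  let l : ℝ →ᵃ[ℝ] E := AffineMap.lineMap x y
  have hl : HasDerivAt (F ∘ l) ⟪f' x, y - x⟫ 0 := by
    have hd' : HasFDerivAt F (InnerProductSpace.toDual ℝ E (f' x)) (l 0) := by
      simpa [l] using hd.hasFDerivAt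
    simpa using hd'.comp_hasDerivAt (0 : ℝ) AffineMap.hasDerivAt_lineMap
  have hslope := (hF.comp_affineMap l).le_slope_of_hasDerivAt (x := 0) (y := 1)
    (by simpa [l] using hx) (by simpa [l] using hy) one_pos hl
  simp only [slope_def_field, Function.comp_apply, l, AffineMap.lineMap_apply_zero,
    AffineMap.lineMap_apply_one, sub_zero, div_one] at hslope
  unfold bregmanDiv
  linarith

/-- Joint convexity makes the divergence convex in its second argument. -/
theorem convexOn_bregmanDiv_right {S : Set E} {F : E → ℝ} {f' : E → E} {z : E}
    (hS : Convex ℝ S)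
    (hjc : ConvexOn ℝ (S ×ˢ S) (fun p : E × E => bregmanDiv F f' p.1 p.2)) (hz : z ∈ S) :
    ConvexOn ℝ S (bregmanDiv F f' z) := by
  refine ⟨hS, fun x hx y hy a b ha hb hab => ?_⟩
  have h := hjc.2 (Set.mk_mem_prod hz hx) (Set.mk_mem_prod hz hy) ha hb hab
  simpa [← add_smul, hab] using h

/-- The Bregman divergence in its second argument is a.e. strongly measurable for the law of
`X`. -/
theorem aestronglyMeasurable_bregmanDiv_map [MeasurableSpace E] [BorelSpace E]
    {Ω : Type*} [MeasurableSpace Ω] {μ : Measure Ω} {F : E → ℝ} {f' : E → E} {X : Ω → E}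
    (hF : Measurable F) (hf' : Measurable f') (hX : Measurable X)
    (hXs : AEStronglyMeasurable X μ) (hf'X : AEStronglyMeasurable (fun ω => f' (X ω)) μ)
    (z : E) : AEStronglyMeasurable (bregmanDiv F f' z) (μ.map X) := by
  have hid : AEStronglyMeasurable (fun x : E => x) (μ.map X) :=
    aestronglyMeasurable_map_of_comp hX measurable_id hXs
  exact (aestronglyMeasurable_const.sub hF.aestronglyMeasurable).sub
    ((aestronglyMeasurable_map_of_comp hX hf' hf'X).inner (aestronglyMeasurable_const.sub hid))

/-- The dual mean of `X` minimizes the expected divergence. -/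
theorem integral_bregmanDiv_dualMean_le [CompleteSpace E] {Ω : Type*} [MeasurableSpace Ω]
    {μ : Measure Ω} [IsProbabilityMeasure μ] {S : Set E} {F : E → ℝ} {f' : E → E} {X : Ω → E}
    {y z : E} (hF : ConvexOn ℝ S F) (hy : y ∈ S) (hz : z ∈ S) (hd : HasGradientAt F (f' z) z)
    (hf'X : Integrable (fun ω => f' (X ω)) μ) (hmean : f' z = ∫ ω, f' (X ω) ∂μ)
    (hDz : Integrable (fun ω => bregmanDiv F f' z (X ω)) μ) :
    ∫ ω, bregmanDiv F f' z (X ω) ∂μ ≤ ∫ ω, bregmanDiv F f' y (X ω) ∂μ := by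
  have hsub : Integrable (fun ω => f' z - f' (X ω)) μ := (integrable_const _).sub hf'X
  have hinner : ∫ ω, ⟪f' z - f' (X ω), y - z⟫ ∂μ = 0 := by
    rw [integral_congr_ae (.of_forall fun ω => real_inner_comm (y - z) (f' z - f' (X ω))),
      integral_inner hsub, integral_sub (integrable_const _) hf'X, ← hmean]
    simp
  have hsum : Integrable (fun ω => bregmanDiv F f' z (X ω) + bregmanDiv F f' y z) μ :=
    hDz.add (integrable_const _)
  rw [integral_congr_ae (.of_forall fun ω => bregmanDiv_three_point F f' y z (X ω)),
    integral_add hsum (hsub.inner_const _),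
    integral_add hDz (integrable_const _), hinner]
  simpa using bregmanDiv_nonneg hF hz hy hd

end Bregman

/-- if `D_F` is jointly convex on `S × S`, primal averaging does not
increase the dual variance: with `X̂ := (1/n) ∑ᵢ Xᵢ`, `z₀ ∈ S` the dual mean of `X`
(`∇F(z₀) = E[∇F(X)]`) and `ẑ ∈ S` the dual mean of `X̂` (`∇F(ẑ) = E[∇F(X̂)]`),
`E[D_F(ẑ, X̂)] ≤ E[D_F(z₀, X)]`. -/
theorem primal_averaging_dual_variance
    {E : Type*} [NormedAddCommGroup E] [InnerProductSpace ℝ E] [CompleteSpace E]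
    [MeasurableSpace E] [BorelSpace E]
    {Ω : Type*} [MeasurableSpace Ω] (μ : Measure Ω) [IsProbabilityMeasure μ]
    (S : Set E) (hS : Convex ℝ S) (F : E → ℝ) (f' : E → E)
    (hF : StrictConvexOn ℝ S F) (hdiff : ∀ x ∈ S, HasGradientAt F (f' x) x)
    (hFmeas : Measurable F) (hf'meas : Measurable f')
    (hjc : ConvexOn ℝ (S ×ˢ S) (fun p : E × E => bregmanDiv F f' p.1 p.2))
    (n : ℕ) (hn : 1 ≤ n)
    (X : Ω → E) (Xs : Fin n → Ω → E)
    (hXm : Measurable X) (hXsm : ∀ i, Measurable (Xs i))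
    (hXS : ∀ ω, X ω ∈ S) (hXsS : ∀ i ω, Xs i ω ∈ S)
    (hid : ∀ i, IdentDistrib (Xs i) X μ μ)
    (Xhat : Ω → E) (hXhat : ∀ ω, Xhat ω = (n : ℝ)⁻¹ • ∑ i, Xs i ω)
    (hXint : Integrable X μ)
    (hf'X : Integrable (fun ω => f' (X ω)) μ)
    (hf'Xhat : Integrable (fun ω => f' (Xhat ω)) μ)
    (z₀ : E) (hz₀S : z₀ ∈ S) (hz₀ : f' z₀ = ∫ ω, f' (X ω) ∂μ)
    (zhat : E) (hzhatS : zhat ∈ S) (hzhat : f' zhat = ∫ ω, f' (Xhat ω) ∂μ)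
    (hD0 : Integrable (fun ω => bregmanDiv F f' z₀ (X ω)) μ)
    (hD1 : Integrable (fun ω => bregmanDiv F f' zhat (Xhat ω)) μ)
    (hD2 : Integrable (fun ω => bregmanDiv F f' z₀ (Xhat ω)) μ) :
    (∫ ω, bregmanDiv F f' zhat (Xhat ω) ∂μ)
      ≤ ∫ ω, bregmanDiv F f' z₀ (X ω) ∂μ := by
  have hmap (i : Fin n) : μ.map (Xs i) = μ.map X := (hid i).map_eq
  have hmeas : AEStronglyMeasurable (bregmanDiv F f' z₀) (μ.map X) :=
    aestronglyMeasurable_bregmanDiv_map hFmeas hf'meas hXm hXint.1 hf'X.1 z₀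
  have hmeas' (i : Fin n) : AEStronglyMeasurable (bregmanDiv F f' z₀) (μ.map (Xs i)) :=
    hmap i ▸ hmeas
  have hint (i : Fin n) : Integrable (fun ω => bregmanDiv F f' z₀ (Xs i ω)) μ := by
    refine (integrable_map_measure (hmeas' i) (hXsm i).aemeasurable).1 ?_
    rw [hmap i]
    exact (integrable_map_measure hmeas hXm.aemeasurable).2 hD0
  have heq (i : Fin n) : ∫ ω, bregmanDiv F f' z₀ (Xs i ω) ∂μ
      = ∫ ω, bregmanDiv F f' z₀ (X ω) ∂μ := by
    rw [← integral_map (hXsm i).aemeasurable (hmeas' i), hmap i,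
      integral_map hXm.aemeasurable hmeas]
  have hn0 : (n : ℝ) ≠ 0 := by positivity
  have hle (ω : Ω) : bregmanDiv F f' z₀ (Xhat ω)
      ≤ ∑ i, (n : ℝ)⁻¹ * bregmanDiv F f' z₀ (Xs i ω) := by
    rw [hXhat ω, Finset.smul_sum]
    exact (convexOn_bregmanDiv_right hS hjc hz₀S).map_sum_le (fun _ _ => by positivity)
      (by simp [hn0]) (fun i _ => hXsS i ω)
  calc ∫ ω, bregmanDiv F f' zhat (Xhat ω) ∂μ
      ≤ ∫ ω, bregmanDiv F f' z₀ (Xhat ω) ∂μ :=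
        integral_bregmanDiv_dualMean_le hF.convexOn hz₀S hzhatS (hdiff _ hzhatS) hf'Xhat hzhat hD1
    _ ≤ ∫ ω, ∑ i, (n : ℝ)⁻¹ * bregmanDiv F f' z₀ (Xs i ω) ∂μ :=
        integral_mono hD2 (integrable_finsetSum _ fun i _ => (hint i).const_mul _) hle
    _ = ∫ ω, bregmanDiv F f' z₀ (X ω) ∂μ := by
        rw [integral_finsetSum _ fun i _ => (hint i).const_mul _]
        simp [integral_const_mul, heq, hn0]
end

section
/- Dual averaging does not increase the dual variance: if X₁, …, Xₙ are S-valued random variables each identically distributed as X, X̄ := g((1/n)·∑ᵢ ∇F(Xᵢ)) is their dual average, and z₀ := g(E[∇F(X)]) is the dual mean of X (which, by the previous bias statement, is also the dual mean of X̄), then E[D_F(z₀, X̄)] ≤ E[D_F(z₀, X)]. -/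
open MeasureTheory ProbabilityTheory
open scoped RealInnerProductSpace

/-- The inner product of a strongly measurable and a measurable function is measurable, without
any separability assumption on the space. -/
theorem measurable_inner_of_stronglyMeasurable
    {α E : Type*} [MeasurableSpace α] [NormedAddCommGroup E] [InnerProductSpace ℝ E]
    [MeasurableSpace E] [BorelSpace E] {u v : α → E}
    (hu : StronglyMeasurable u) (hv : Measurable v) :
    Measurable fun a => ⟪u a, v a⟫ := by
  refine measurable_of_tendsto_metrizable (f := fun k a => ⟪hu.approx k a, v a⟫) (fun k => ?_) ?_
  · exact (hu.approx k).measurable_bind (fun b a => ⟪b, v a⟫)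
      fun b => (continuous_const.inner continuous_id).measurable.comp hv
  · exact tendsto_pi_nhds.2 fun a => (hu.tendsto_approx a).inner tendsto_const_nhds

/-- If `f'` is measurable and `f' ∘ X` is almost everywhere strongly measurable, then the Bregman
divergence is measurable in its second argument up to null sets of the law of `X`. -/
theorem aemeasurable_bregmanDiv_map
    {Ω E : Type*} [MeasurableSpace Ω] [NormedAddCommGroup E] [InnerProductSpace ℝ E]
    [MeasurableSpace E] [BorelSpace E] {μ : Measure Ω} {F : E → ℝ} {f' : E → E} {X : Ω → E}
    (hF : Measurable F) (hf' : Measurable f') (hX : Measurable X)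
    (hf'X : AEStronglyMeasurable (fun ω => f' (X ω)) μ) (z : E) :
    AEMeasurable (fun x => bregmanDiv F f' z x) (μ.map X) := by
  obtain ⟨-, t, ht, hmem⟩ := aestronglyMeasurable_iff_aemeasurable_separable.1 hf'X
  have hsm : AEStronglyMeasurable f' (μ.map X) := by
    refine aestronglyMeasurable_iff_aemeasurable_separable.2
      ⟨hf'.aemeasurable, closure t, ht.closure, ?_⟩
    rw [ae_map_iff hX.aemeasurable (hf' isClosed_closure.measurableSet)]
    exact hmem.mono fun ω h => subset_closure h
  obtain ⟨u, hu, hfu⟩ := hsm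
  refine ⟨fun x => F z - F x - ⟪u x, z - x⟫, ?_, ?_⟩
  · exact (hF.const_sub _).sub (measurable_inner_of_stronglyMeasurable hu
      (continuous_const.sub continuous_id).measurable)
  · filter_upwards [hfu] with x hx
    simp only [bregmanDiv, hx]

/-- Dual expression of the Bregman divergence through the conjugate function. -/
theorem bregmanDiv_apply_dual
    {E : Type*} [NormedAddCommGroup E] [InnerProductSpace ℝ E] {F : E → ℝ} {f' g : E → E}
    {p : E} (hg : f' (g p) = p) (z : E) :
    bregmanDiv F f' z (g p) = F z + (⟪g p, p⟫ - F (g p)) - ⟪p, z⟫ := by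
  rw [bregmanDiv, hg, inner_sub_right, real_inner_comm p (g p)]
  ring

/-- The Bregman divergence from a fixed point is convex in the dual coordinate. -/
theorem convexOn_bregmanDiv_dual
    {E : Type*} [NormedAddCommGroup E] [InnerProductSpace ℝ E] {F : E → ℝ} {f' g : E → E}
    (hg : ∀ p, f' (g p) = p)
    (hconv : ConvexOn ℝ Set.univ fun p : E => ⟪g p, p⟫ - F (g p)) (z : E) :
    ConvexOn ℝ Set.univ fun p => bregmanDiv F f' z (g p) := by
  refine ⟨convex_univ, fun p hp q hq a b ha hb hab => ?_⟩
  have h := hconv.2 hp hq ha hb hab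
  simp only [bregmanDiv_apply_dual (hg _), inner_add_left (a • p), real_inner_smul_left,
    smul_eq_mul] at h ⊢
  linear_combination h - F z * hab

/-- dual averaging does not increase the dual variance: with
`X̄ := g((1/n) ∑ᵢ ∇F(Xᵢ))` the dual average and `z₀ := g(E[∇F(X)])` the dual mean
of `X`, and assuming the conjugate `F*(p) := ⟪g p, p⟫ - F (g p)` is convex,
`E[D_F(z₀, X̄)] ≤ E[D_F(z₀, X)]`. -/
theorem dual_averaging_variance_reduction
    {E : Type*} [NormedAddCommGroup E] [InnerProductSpace ℝ E] [CompleteSpace E]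
    [MeasurableSpace E] [BorelSpace E]
    {Ω : Type*} [MeasurableSpace Ω] (μ : Measure Ω) [IsProbabilityMeasure μ]
    (S : Set E) (hS : Convex ℝ S) (F : E → ℝ) (f' : E → E)
    (hF : StrictConvexOn ℝ S F) (hdiff : ∀ x ∈ S, HasGradientAt F (f' x) x)
    (hFmeas : Measurable F) (hf'meas : Measurable f')
    (g : E → E) (hgS : ∀ p, g p ∈ S)
    (hg1 : ∀ x ∈ S, g (f' x) = x) (hg2 : ∀ p, f' (g p) = p)
    (hFstarConv : ConvexOn ℝ Set.univ (fun p : E => ⟪g p, p⟫ - F (g p)))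
    (n : ℕ) (hn : 1 ≤ n)
    (X : Ω → E) (Xs : Fin n → Ω → E)
    (hXm : Measurable X) (hXsm : ∀ i, Measurable (Xs i))
    (hXS : ∀ ω, X ω ∈ S) (hXsS : ∀ i ω, Xs i ω ∈ S)
    (hid : ∀ i, IdentDistrib (Xs i) X μ μ)
    (hf'X : Integrable (fun ω => f' (X ω)) μ)
    (Xbar : Ω → E) (hXbar : ∀ ω, Xbar ω = g ((n : ℝ)⁻¹ • ∑ i, f' (Xs i ω)))
    (z₀ : E) (hz₀ : z₀ = g (∫ ω, f' (X ω) ∂μ))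
    (hD0 : Integrable (fun ω => bregmanDiv F f' z₀ (X ω)) μ)
    (hD1 : Integrable (fun ω => bregmanDiv F f' z₀ (Xbar ω)) μ) :
    (∫ ω, bregmanDiv F f' z₀ (Xbar ω) ∂μ)
      ≤ ∫ ω, bregmanDiv F f' z₀ (X ω) ∂μ := by
  have hXs (i : Fin n) : IdentDistrib (fun ω => bregmanDiv F f' z₀ (Xs i ω))
      (fun ω => bregmanDiv F f' z₀ (X ω)) μ μ := by
    refine (hid i).comp_of_aemeasurable (u := bregmanDiv F f' z₀) ?_
    rw [(hid i).map_eq]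
    exact aemeasurable_bregmanDiv_map hFmeas hf'meas hXm hf'X.aestronglyMeasurable z₀
  have hint (i : Fin n) : Integrable (fun ω => bregmanDiv F f' z₀ (Xs i ω)) μ :=
    (hXs i).integrable_iff.2 hD0
  have hn0 : (n : ℝ) ≠ 0 := by positivity
  have hle (ω : Ω) : bregmanDiv F f' z₀ (Xbar ω)
      ≤ ∑ i, (n : ℝ)⁻¹ * bregmanDiv F f' z₀ (Xs i ω) := by
    have h := (convexOn_bregmanDiv_dual hg2 hFstarConv z₀).map_sum_le (t := Finset.univ)
      (w := fun _ : Fin n => (n : ℝ)⁻¹) (p := fun i => f' (Xs i ω))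
      (fun _ _ => by positivity) (by simp [hn0]) (fun _ _ => Set.mem_univ _)
    simpa only [hXbar, Finset.smul_sum, smul_eq_mul, hg1 _ (hXsS _ ω)] using h
  calc ∫ ω, bregmanDiv F f' z₀ (Xbar ω) ∂μ
      ≤ ∫ ω, ∑ i, (n : ℝ)⁻¹ * bregmanDiv F f' z₀ (Xs i ω) ∂μ :=
        integral_mono hD1 (integrable_finsetSum _ fun i _ => (hint i).const_mul _) hle
    _ = ∑ i : Fin n, (n : ℝ)⁻¹ * ∫ ω, bregmanDiv F f' z₀ (X ω) ∂μ := by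
        rw [integral_finsetSum _ fun i _ => (hint i).const_mul _]
        simp only [integral_const_mul, (hXs _).integral_eq]
    _ = ∫ ω, bregmanDiv F f' z₀ (X ω) ∂μ := by
        simp [hn0]
end
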